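/- arXiv:1302.6435 — 2 statements merged into one kernel-verified Lean document; each statement's English description precedes it below -/
import Mathlib

section
/- For every β ∈ ℂ, ( ∏_{i=1}^{2p₊−1} ∏_{j=1}^{2p₋−1} (β − β_{i,j}) )² = 2^{(2p₊−1)(2p₋−1)} · [ ∏_{i=1}^{p₊−1} ∏_{j=1}^{p₋−1} (h_β − h_{i,j})² · (h_β − h_{2p₊−i,j})² ] · [ ∏_{i=1}^{p₊−1} (h_β − h_{2p₊−i,p₋})² ] · [ ∏_{j=1}^{p₋−1} (h_β − h_{p₊,2p₋−j})² ] · (h_β − h_{p₊,p₋}). (This is the factorization g₁(h_β) = ω₁(β)², up to a nonzero constant, of the square of the zero-mode eigenvalue ω₁(β) of W_{1,0}[0]: the factors h_β − h_{i,j} run over the Kac-table weights Δ_{i,j} with exponent 4 per equivalence class, and the remaining factors are h_β − Δ⁺_{r,s;0} for 1 ≤ r ≤ p₊, 1 ≤ s ≤ p₋, squared except at the corner (p₊,p₋).) -/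
/-- `α₊ = √(2p₋/p₊)` regarded as a complex number. -/
noncomputable def alphaP (pp pm : ℕ) : ℂ := ((Real.sqrt (2 * (pm : ℝ) / (pp : ℝ)) : ℝ) : ℂ)

/-- `α₋ = −√(2p₊/p₋)` regarded as a complex number. -/
noncomputable def alphaM (pp pm : ℕ) : ℂ := -((Real.sqrt (2 * (pp : ℝ) / (pm : ℝ)) : ℝ) : ℂ)

/-- `α₀ = α₊ + α₋`. -/
noncomputable def alpha0 (pp pm : ℕ) : ℂ := alphaP pp pm + alphaM pp pm

/-- The conformal weight `h_β = β(β − α₀)/2`. -/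
noncomputable def hwt (pp pm : ℕ) (β : ℂ) : ℂ := β * (β - alpha0 pp pm) / 2

/-- `β_{r,s} = ((1−r)/2)·α₊ + ((1−s)/2)·α₋`. -/
noncomputable def betaRS (pp pm : ℕ) (r s : ℤ) : ℂ :=
  (((1 - r : ℤ) : ℂ) / 2) * alphaP pp pm + (((1 - s : ℤ) : ℂ) / 2) * alphaM pp pm

/-- `h_{r,s} = h_{β_{r,s}}`. -/
noncomputable def hRS (pp pm : ℕ) (r s : ℤ) : ℂ := hwt pp pm (betaRS pp pm r s)

/-- A product over `1, …, 2n - 1` is folded about its midpoint `n`. -/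
theorem prod_Icc_fold {M : Type*} [CommMonoid M] (g : ℤ → M) {n : ℕ} (hn : 1 ≤ n) :
    ∏ i ∈ Finset.Icc 1 (2 * n - 1), g (i : ℤ)
      = (∏ i ∈ Finset.Icc 1 (n - 1), (g (i : ℤ) * g (2 * (n : ℤ) - (i : ℤ)))) * g (n : ℤ) := by
  have hIcc : ∀ m : ℕ, 1 ≤ m → Finset.Icc 1 (m - 1) = Finset.Ico 1 m := fun m hm => by
    ext x
    simp only [Finset.mem_Icc, Finset.mem_Ico]
    omega
  have hrefl : ∏ i ∈ Finset.Ico 1 n, g (2 * (n : ℤ) - (i : ℤ))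
      = ∏ i ∈ Finset.Ico (n + 1) (2 * n), g (i : ℤ) := by
    have h := Finset.prod_Ico_reflect (fun i : ℕ => g (i : ℤ)) 1 (m := n) (n := 2 * n) (by omega)
    rw [show 2 * n + 1 - n = n + 1 by omega, show 2 * n + 1 - 1 = 2 * n by omega] at h
    rw [← h]
    refine Finset.prod_congr rfl fun i hi => ?_
    rw [Finset.mem_Ico] at hi
    congr 1
    omega
  rw [hIcc _ (by omega), hIcc _ hn, Finset.prod_mul_distrib, hrefl,
    ← Finset.prod_Ico_consecutive _ hn (by omega : n ≤ 2 * n),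
    Finset.prod_eq_prod_Ico_succ_bot (by omega : n < 2 * n), mul_assoc,
    mul_comm (g (n : ℤ))]

/-- A product over `1, …, 2n - 1` is invariant under `i ↦ 2n - i`. -/
theorem prod_Icc_two_mul_sub {M : Type*} [CommMonoid M] (g : ℤ → M) {n : ℕ} (hn : 1 ≤ n) :
    ∏ i ∈ Finset.Icc 1 (2 * n - 1), g (2 * (n : ℤ) - (i : ℤ))
      = ∏ i ∈ Finset.Icc 1 (2 * n - 1), g (i : ℤ) := by
  rw [prod_Icc_fold g hn, prod_Icc_fold (fun i => g (2 * (n : ℤ) - i)) hn]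
  simp only [sub_sub_cancel]
  rw [show 2 * (n : ℤ) - n = n by ring]
  simp only [mul_comm]

/-- If `K` is invariant under the point reflection of the grid, its product over the grid is
determined by two quadrants, two half-axes and the centre. -/
theorem prod_grid_of_reflection_invariant {M : Type*} [CommMonoid M] (K : ℤ → ℤ → M) {p q : ℕ}
    (hp : 1 ≤ p) (hq : 1 ≤ q) (hK : ∀ i j, K (2 * (p : ℤ) - i) (2 * (q : ℤ) - j) = K i j) :
    ∏ i ∈ Finset.Icc 1 (2 * p - 1), ∏ j ∈ Finset.Icc 1 (2 * q - 1), K (i : ℤ) (j : ℤ)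
      = (∏ i ∈ Finset.Icc 1 (p - 1), ∏ j ∈ Finset.Icc 1 (q - 1),
            (K (i : ℤ) (j : ℤ) ^ 2 * K (2 * (p : ℤ) - (i : ℤ)) (j : ℤ) ^ 2)) *
        (∏ i ∈ Finset.Icc 1 (p - 1), K (2 * (p : ℤ) - (i : ℤ)) (q : ℤ) ^ 2) *
        (∏ j ∈ Finset.Icc 1 (q - 1), K (p : ℤ) (2 * (q : ℤ) - (j : ℤ)) ^ 2) *
        K (p : ℤ) (q : ℤ) := by
  have hK₁ : ∀ i j, K i (2 * (q : ℤ) - j) = K (2 * (p : ℤ) - i) j := fun i j => by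
    rw [← hK, sub_sub_cancel]
  have hKq : ∀ i, K i q = K (2 * (p : ℤ) - i) q := fun i => by
    rw [← hK₁]
    congr 1
    ring
  have hKp : ∀ j, K p j = K p (2 * (q : ℤ) - j) := fun j => by
    rw [hK₁]
    congr 1
    ring
  rw [prod_Icc_fold (fun i => ∏ j ∈ Finset.Icc 1 (2 * q - 1), K i (j : ℤ)) hp]
  simp only [fun i => prod_Icc_fold (K i) hq]
  rw [← mul_assoc, ← Finset.prod_mul_distrib]
  congr 2
  · refine Finset.prod_congr rfl fun i _ => ?_
    rw [hKq i, mul_mul_mul_comm, ← Finset.prod_mul_distrib, ← sq]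
    congr 1
    refine Finset.prod_congr rfl fun j _ => ?_
    rw [hK, hK₁, mul_comm (K (2 * (p : ℤ) - i) j), ← sq, mul_pow]
  · refine Finset.prod_congr rfl fun j _ => ?_
    rw [hKp j, sq]

theorem mul_alphaP_add_mul_alphaM {pp pm : ℕ} (hpp : 0 < pp) (hpm : 0 < pm) :
    (pp : ℂ) * alphaP pp pm + (pm : ℂ) * alphaM pp pm = 0 := by
  have h : ∀ a b : ℝ, 0 < a → 0 ≤ b → a * Real.sqrt (2 * b / a) = Real.sqrt (2 * a * b) :=
    fun a b ha hb => by
      rw [show 2 * a * b = a ^ 2 * (2 * b / a) by field_simp,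
        Real.sqrt_mul (sq_nonneg a), Real.sqrt_sq ha.le]
  have hreal : (pp : ℝ) * Real.sqrt (2 * pm / pp) = pm * Real.sqrt (2 * pp / pm) := by
    rw [h _ _ (by exact_mod_cast hpp) (by positivity), h _ _ (by exact_mod_cast hpm) (by positivity)]
    congr 1
    ring
  have hcomplex := congrArg (fun x : ℝ => (x : ℂ)) hreal
  push_cast at hcomplex
  simp only [alphaP, alphaM]
  linear_combination hcomplex

/-- Reflecting the indices about `(p₊, p₋)` reflects `β_{r,s}` about `α₀ / 2`. -/
theorem betaRS_reflect {pp pm : ℕ} (hpp : 0 < pp) (hpm : 0 < pm) (r s : ℤ) :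
    betaRS pp pm (2 * (pp : ℤ) - r) (2 * (pm : ℤ) - s) = alpha0 pp pm - betaRS pp pm r s := by
  simp only [betaRS, alpha0]
  push_cast
  linear_combination -mul_alphaP_add_mul_alphaM hpp hpm

theorem hRS_reflect {pp pm : ℕ} (hpp : 0 < pp) (hpm : 0 < pm) (r s : ℤ) :
    hRS pp pm (2 * (pp : ℤ) - r) (2 * (pm : ℤ) - s) = hRS pp pm r s := by
  simp only [hRS, betaRS_reflect hpp hpm, hwt]
  ring

theorem sub_betaRS_mul_sub_betaRS_reflect {pp pm : ℕ} (hpp : 0 < pp) (hpm : 0 < pm) (β : ℂ)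
    (r s : ℤ) :
    (β - betaRS pp pm r s) * (β - betaRS pp pm (2 * (pp : ℤ) - r) (2 * (pm : ℤ) - s))
      = 2 * (hwt pp pm β - hRS pp pm r s) := by
  simp only [hRS, betaRS_reflect hpp hpm, hwt]
  ring

/-- the factorization `ω₁(β)² = 2^{(2p₊−1)(2p₋−1)} · g₁(h_β)` of
the square of the zero-mode eigenvalue of `W_{1,0}[0]`. -/
theorem omega1_sq_factorization (pp pm : ℕ) (hpp : 2 ≤ pp) (hpm : 2 ≤ pm)
    (hco : Nat.Coprime pp pm) (β : ℂ) :
    (∏ i ∈ Finset.Icc 1 (2 * pp - 1), ∏ j ∈ Finset.Icc 1 (2 * pm - 1),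
        (β - betaRS pp pm (i : ℤ) (j : ℤ))) ^ 2
      = 2 ^ ((2 * pp - 1) * (2 * pm - 1)) *
        (∏ i ∈ Finset.Icc 1 (pp - 1), ∏ j ∈ Finset.Icc 1 (pm - 1),
            ((hwt pp pm β - hRS pp pm (i : ℤ) (j : ℤ)) ^ 2 *
              (hwt pp pm β - hRS pp pm (2 * (pp : ℤ) - (i : ℤ)) (j : ℤ)) ^ 2)) *
        (∏ i ∈ Finset.Icc 1 (pp - 1),
            (hwt pp pm β - hRS pp pm (2 * (pp : ℤ) - (i : ℤ)) (pm : ℤ)) ^ 2) *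
        (∏ j ∈ Finset.Icc 1 (pm - 1),
            (hwt pp pm β - hRS pp pm (pp : ℤ) (2 * (pm : ℤ) - (j : ℤ))) ^ 2) *
        (hwt pp pm β - hRS pp pm (pp : ℤ) (pm : ℤ)) := by
  have hp : 0 < pp := by omega
  have hq : 0 < pm := by omega
  have hgrid := prod_grid_of_reflection_invariant
    (fun i j => hwt pp pm β - hRS pp pm i j) hp hq (fun i j => by rw [hRS_reflect hp hq])
  have hrefl : ∏ i ∈ Finset.Icc 1 (2 * pp - 1), ∏ j ∈ Finset.Icc 1 (2 * pm - 1),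
        (β - betaRS pp pm (2 * (pp : ℤ) - (i : ℤ)) (2 * (pm : ℤ) - (j : ℤ)))
      = ∏ i ∈ Finset.Icc 1 (2 * pp - 1), ∏ j ∈ Finset.Icc 1 (2 * pm - 1),
        (β - betaRS pp pm (i : ℤ) (j : ℤ)) := by
    rw [← prod_Icc_two_mul_sub
      (fun i => ∏ j ∈ Finset.Icc 1 (2 * pm - 1), (β - betaRS pp pm i (j : ℤ))) hp]
    exact Finset.prod_congr rfl fun i _ =>
      prod_Icc_two_mul_sub (fun j => β - betaRS pp pm (2 * (pp : ℤ) - (i : ℤ)) j) hq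
  rw [sq]
  nth_rewrite 2 [← hrefl]
  simp only [← Finset.prod_mul_distrib, sub_betaRS_mul_sub_betaRS_reflect hp hq]
  simp only [Finset.prod_mul_distrib, Finset.prod_const, Nat.card_Icc, Nat.add_sub_cancel]
    at hgrid ⊢
  rw [hgrid, ← pow_mul, mul_comm (2 * pm - 1)]
  simp only [mul_assoc]
end

section
/- Define the sets of complex numbers A = { h_{r,s} : 1 ≤ r ≤ p₊−1, 1 ≤ s ≤ p₋−1 }, B = { h_{2p₊−r,s} : 1 ≤ r ≤ p₊, 1 ≤ s ≤ p₋ }, and C = { h_{3p₊−r,s} : 1 ≤ r ≤ p₊, 1 ≤ s ≤ p₋ }. Then A, B and C are pairwise disjoint, |A| = (p₊−1)(p₋−1)/2, and |B| = |C| = p₊p₋. In particular A ∪ B ∪ C has cardinality (p₊−1)(p₋−1)/2 + 2p₊p₋. (A consists of the Kac-table weights Δ_{r,s}, B of the weights Δ⁺_{r,s;0}, and C of the weights Δ⁻_{r,s;0}; these are the lowest conformal weights of the (p₊−1)(p₋−1)/2 + 2p₊p₋ simple M_{p₊,p₋}-modules, and they are pairwise distinct.) -/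
/-- `h_{r,s}` in terms of the integer `r p₋ - s p₊`. -/
theorem hRS_eq (pp pm : ℕ) (hp : pp ≠ 0) (hm : pm ≠ 0) (r s : ℤ) :
    hRS pp pm r s =
      (((r * pm - s * pp : ℤ) : ℂ) ^ 2 - ((pm : ℂ) - pp) ^ 2) / (4 * pp * pm) := by
  have hpR : (0 : ℝ) < pp := by positivity
  have hmR : (0 : ℝ) < pm := by positivity
  have hpC : (pp : ℂ) ≠ 0 := by exact_mod_cast hp
  have hmC : (pm : ℂ) ≠ 0 := by exact_mod_cast hm
  have sqP : alphaP pp pm ^ 2 = 2 * pm / pp := by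
    rw [alphaP, ← Complex.ofReal_pow, Real.sq_sqrt (by positivity)]
    push_cast
    rfl
  have sqM : alphaM pp pm ^ 2 = 2 * pp / pm := by
    rw [alphaM, neg_sq, ← Complex.ofReal_pow, Real.sq_sqrt (by positivity)]
    push_cast
    rfl
  have mulPM : alphaP pp pm * alphaM pp pm = -2 := by
    rw [alphaP, alphaM, mul_neg, ← Complex.ofReal_mul, ← Real.sqrt_mul (by positivity),
      show 2 * (pm : ℝ) / pp * (2 * pp / pm) = 2 ^ 2 by field_simp,
      Real.sqrt_sq (by norm_num)]
    norm_num
  have expand : hRS pp pm r s =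
      ((r ^ 2 - 1) * alphaP pp pm ^ 2 + 2 * (r * s - 1) * (alphaP pp pm * alphaM pp pm) +
        (s ^ 2 - 1) * alphaM pp pm ^ 2) / 8 := by
    simp only [hRS, hwt, betaRS, alpha0]
    push_cast
    ring
  rw [expand, sqP, sqM, mulPM]
  push_cast
  field_simp
  ring

theorem hRS_eq_hRS_iff {pp pm : ℕ} (hp : pp ≠ 0) (hm : pm ≠ 0) {r s r' s' : ℤ} :
    hRS pp pm r s = hRS pp pm r' s' ↔
      r * pm - s * pp = r' * pm - s' * pp ∨ r * pm - s * pp = -(r' * pm - s' * pp) := by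
  have hpC : (pp : ℂ) ≠ 0 := by exact_mod_cast hp
  have hmC : (pm : ℂ) ≠ 0 := by exact_mod_cast hm
  rw [hRS_eq pp pm hp hm, hRS_eq pp pm hp hm, div_left_inj' (by simp [hpC, hmC]), sub_left_inj,
    ← sq_eq_sq_iff_eq_or_eq_neg]
  norm_cast

/-- A solution of `x q = y p` with `p`, `q` coprime is an integer multiple of `(p, q)`, and the
multiplier is pinned down strictly between `a` and `b` by bounds on `x`. -/
theorem exists_multiplier_of_mul_eq_mul {p q : ℕ} (hp : 0 < p) (hco : Nat.Coprime p q)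
    {x y : ℤ} (h : x * q = y * p) (a b : ℤ) (ha : a * p < x) (hb : x < b * p) :
    ∃ k : ℤ, a < k ∧ k < b ∧ x = k * p ∧ y = k * q := by
  have hp' : (0 : ℤ) < p := by exact_mod_cast hp
  obtain ⟨k, rfl⟩ : (p : ℤ) ∣ x :=
    (Nat.isCoprime_iff_coprime.mpr hco).dvd_of_dvd_mul_right ⟨y, by rw [h, mul_comm]⟩
  refine ⟨k, ?_, ?_, mul_comm _ _, ?_⟩
  · exact lt_of_mul_lt_mul_right (by linarith) hp'.le
  · exact lt_of_mul_lt_mul_right (by linarith) hp'.le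
  · exact mul_right_cancel₀ hp'.ne' (by rw [← h]; ring)

/-- The only coincidences in the Kac table are `(r, s) ∼ (p₊ - r, p₋ - s)`. -/
theorem hRS_eq_hRS_iff_of_mem_kacTable {pp pm : ℕ} (hpp : 0 < pp) (hpm : 0 < pm)
    (hco : Nat.Coprime pp pm) {r s r' s' : ℤ} (hr : 1 ≤ r) (hr₂ : r ≤ pp - 1)
    (hr' : 1 ≤ r') (hr₂' : r' ≤ pp - 1) :
    hRS pp pm r s = hRS pp pm r' s' ↔ r = r' ∧ s = s' ∨ r = pp - r' ∧ s = pm - s' := by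
  rw [hRS_eq_hRS_iff hpp.ne' hpm.ne']
  constructor
  · rintro (h | h)
    · obtain ⟨k, hk₁, hk₂, hx, hy⟩ := exists_multiplier_of_mul_eq_mul hpp hco
        (x := r - r') (y := s - s') (by linarith) (-1) 1 (by linarith) (by linarith)
      obtain rfl : k = 0 := by lia
      left; constructor <;> linarith
    · obtain ⟨k, hk₁, hk₂, hx, hy⟩ := exists_multiplier_of_mul_eq_mul hpp hco
        (x := r + r') (y := s + s') (by linarith) 0 2 (by linarith) (by linarith)
      obtain rfl : k = 1 := by lia
      right; constructor <;> linarith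
  · rintro (⟨rfl, rfl⟩ | ⟨rfl, rfl⟩)
    · exact Or.inl rfl
    · right; ring

/-- A Kac-table weight is never of the form `h_{c p₊ - r, s}` with `c ≥ 2`. -/
theorem hRS_ne_hRS_shift_of_mem_kacTable {pp pm : ℕ} (hpp : 0 < pp) (hpm : 0 < pm)
    (hco : Nat.Coprime pp pm) {c r s r' s' : ℤ} (hc : 2 ≤ c) (hr : 1 ≤ r) (hr₂ : r ≤ pp - 1)
    (hs : 1 ≤ s) (hs₂ : s ≤ pm - 1) (hr' : 1 ≤ r') (hr₂' : r' ≤ pp)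
    (hs₂' : s' ≤ pm) :
    hRS pp pm r s ≠ hRS pp pm (c * pp - r') s' := by
  have hcq : 2 * (pm : ℤ) ≤ c * pm := by gcongr
  rw [Ne, hRS_eq_hRS_iff hpp.ne' hpm.ne']
  rintro (h | h)
  · obtain ⟨k, hk₁, hk₂, hx, hy⟩ := exists_multiplier_of_mul_eq_mul hpp hco
      (x := r + r') (y := c * pm + s - s') (by linarith) 0 2 (by linarith) (by linarith)
    obtain rfl : k = 1 := by lia
    linarith
  · obtain ⟨k, hk₁, hk₂, hx, hy⟩ := exists_multiplier_of_mul_eq_mul hpp hco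
      (x := r' - r) (y := c * pm - s - s') (by linarith) (-1) 1 (by linarith) (by linarith)
    obtain rfl : k = 0 := by lia
    linarith

/-- The weights `h_{c p₊ - r, s}` with `c ≥ 2`, `1 ≤ r ≤ p₊`, `1 ≤ s ≤ p₋` are determined by
`(c, r, s)` without repetition. -/
theorem hRS_shift_inj {pp pm : ℕ} (hpp : 0 < pp) (hpm : 0 < pm)
    (hco : Nat.Coprime pp pm) {c c' r s r' s' : ℤ} (hc : 2 ≤ c) (hc' : 2 ≤ c')
    (hr : 1 ≤ r) (hr₂ : r ≤ pp) (hs : 1 ≤ s) (hs₂ : s ≤ pm) (hr' : 1 ≤ r') (hr₂' : r' ≤ pp)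
    (hs' : 1 ≤ s') (hs₂' : s' ≤ pm)
    (h : hRS pp pm (c * pp - r) s = hRS pp pm (c' * pp - r') s') :
    c = c' ∧ r = r' ∧ s = s' := by
  have hq : (0 : ℤ) < pm := by exact_mod_cast hpm
  have nonneg : ∀ {c r s : ℤ}, 2 ≤ c → r ≤ pp → s ≤ pm →
      0 ≤ (c * pp - r) * (pm : ℤ) - s * pp := by
    intro c r s hc hr hs
    have h₁ : r * (pm : ℤ) ≤ pp * pm := by gcongr
    have h₂ : s * (pp : ℤ) ≤ pm * pp := by gcongr
    have h₃ : 2 * ((pp : ℤ) * pm) ≤ c * (pp * pm) := by gcongr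
    linarith
  have h₁ := nonneg hc hr₂ hs₂
  have h₂ := nonneg hc' hr₂' hs₂'
  rw [hRS_eq_hRS_iff hpp.ne' hpm.ne'] at h
  replace h : (c * pp - r) * (pm : ℤ) - s * pp = (c' * pp - r') * pm - s' * pp := by
    rcases h with h | h <;> linarith
  obtain ⟨k, hk₁, hk₂, hx, hy⟩ := exists_multiplier_of_mul_eq_mul hpp hco
    (x := r - r') (y := (c - c') * pm - s + s') (by linarith) (-1) 1 (by linarith) (by linarith)
  obtain rfl : k = 0 := by lia
  obtain ⟨hc₁, hc₂⟩ : -1 < c - c' ∧ c - c' < 1 :=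
    ⟨lt_of_mul_lt_mul_right (by linarith) hq.le, lt_of_mul_lt_mul_right (by linarith) hq.le⟩
  obtain rfl : c = c' := by lia
  refine ⟨rfl, ?_, ?_⟩ <;> linarith

/-- There are `p₊ p₋` distinct weights `h_{c p₊ - r, s}` for each `c ≥ 2`. -/
theorem card_image_hRS_shift {pp pm : ℕ} (hpp : 0 < pp) (hpm : 0 < pm)
    (hco : Nat.Coprime pp pm) {c : ℤ} (hc : 2 ≤ c) :
    (((Finset.Icc (1 : ℤ) (pp : ℤ)) ×ˢ (Finset.Icc (1 : ℤ) (pm : ℤ))).image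
      (fun x => hRS pp pm (c * (pp : ℤ) - x.1) x.2)).card = pp * pm := by
  rw [Finset.card_image_of_injOn, Finset.card_product]
  · simp
  · rintro ⟨r, s⟩ h ⟨r', s'⟩ h' heq
    simp only [Finset.coe_product, Finset.coe_Icc, Set.mem_prod, Set.mem_Icc] at h h'
    have := hRS_shift_inj hpp hpm hco hc hc h.1.1 h.1.2 h.2.1 h.2.2 h'.1.1 h'.1.2 h'.2.1 h'.2.2 heq
    exact Prod.ext this.2.1 this.2.2

/-- Every Kac-table weight arises from exactly two entries of the Kac table. -/
theorem two_mul_card_image_hRS_kacTable {pp pm : ℕ} (hpp : 2 ≤ pp) (hpm : 0 < pm)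
    (hco : Nat.Coprime pp pm) :
    2 * (((Finset.Icc (1 : ℤ) ((pp : ℤ) - 1)) ×ˢ (Finset.Icc (1 : ℤ) ((pm : ℤ) - 1))).image
      (fun x => hRS pp pm x.1 x.2)).card = (pp - 1) * (pm - 1) := by
  set T := (Finset.Icc (1 : ℤ) ((pp : ℤ) - 1)) ×ˢ (Finset.Icc (1 : ℤ) ((pm : ℤ) - 1)) with hT
  have hpp₀ : 0 < pp := by lia
  have card_T : T.card = (pp - 1) * (pm - 1) := by
    rw [hT, Finset.card_product, Int.card_Icc, Int.card_Icc]
    congr 1 <;> lia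
  have card_fiber : ∀ w ∈ T.image (fun x => hRS pp pm x.1 x.2),
      (T.filter (fun x => hRS pp pm x.1 x.2 = w)).card = 2 := by
    intro w hw
    obtain ⟨⟨r, s⟩, hrs, rfl⟩ := Finset.mem_image.mp hw
    have hrs' := hrs
    simp only [hT, Finset.mem_product, Finset.mem_Icc] at hrs'
    obtain ⟨⟨hr, hr₂⟩, hs, hs₂⟩ := hrs'
    have fiber_eq : T.filter (fun x => hRS pp pm x.1 x.2 = hRS pp pm r s) =
        {(r, s), ((pp : ℤ) - r, (pm : ℤ) - s)} := by
      ext ⟨r', s'⟩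
      simp only [hT, Finset.mem_filter, Finset.mem_product, Finset.mem_Icc, Finset.mem_insert,
        Finset.mem_singleton, Prod.mk.injEq]
      constructor
      · rintro ⟨⟨⟨hr', hr₂'⟩, -⟩, h⟩
        exact (hRS_eq_hRS_iff_of_mem_kacTable hpp₀ hpm hco hr' hr₂' hr hr₂).mp h
      · intro h
        have hr' : 1 ≤ r' := by lia
        have hr₂' : r' ≤ pp - 1 := by lia
        exact ⟨by lia, (hRS_eq_hRS_iff_of_mem_kacTable hpp₀ hpm hco hr' hr₂' hr hr₂).mpr h⟩
    rw [fiber_eq, Finset.card_pair]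
    intro h
    rw [Prod.mk.injEq] at h
    have dvd_p : 2 ∣ pp := by lia
    have dvd_q : 2 ∣ pm := by lia
    exact absurd (Nat.dvd_gcd dvd_p dvd_q) (by rw [hco.gcd_eq_one]; decide)
  rw [← card_T, Finset.card_eq_sum_card_image (fun x : ℤ × ℤ => hRS pp pm x.1 x.2) T,
    Finset.sum_congr rfl card_fiber, Finset.sum_const, smul_eq_mul, mul_comm]

/-- the sets `A = {h_{r,s}}` (Kac-table weights `Δ_{r,s}`),
`B = {h_{2p₊−r,s}}` (the weights `Δ⁺_{r,s;0}`) and `C = {h_{3p₊−r,s}}` (the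
weights `Δ⁻_{r,s;0}`) are pairwise disjoint, with `|A| = (p₊−1)(p₋−1)/2` and
`|B| = |C| = p₊p₋`; in particular `A ∪ B ∪ C` has
`(p₊−1)(p₋−1)/2 + 2p₊p₋` elements: the pairwise distinct lowest conformal
weights of the simple `M_{p₊,p₋}`-modules. -/
theorem simple_module_weights (pp pm : ℕ) (hpp : 2 ≤ pp) (hpm : 2 ≤ pm)
    (hco : Nat.Coprime pp pm) :
    let A : Finset ℂ :=
      ((Finset.Icc (1 : ℤ) ((pp : ℤ) - 1)) ×ˢ (Finset.Icc (1 : ℤ) ((pm : ℤ) - 1))).image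
        (fun x => hRS pp pm x.1 x.2)
    let B : Finset ℂ :=
      ((Finset.Icc (1 : ℤ) (pp : ℤ)) ×ˢ (Finset.Icc (1 : ℤ) (pm : ℤ))).image
        (fun x => hRS pp pm (2 * (pp : ℤ) - x.1) x.2)
    let C : Finset ℂ :=
      ((Finset.Icc (1 : ℤ) (pp : ℤ)) ×ˢ (Finset.Icc (1 : ℤ) (pm : ℤ))).image
        (fun x => hRS pp pm (3 * (pp : ℤ) - x.1) x.2)
    Disjoint A B ∧ Disjoint A C ∧ Disjoint B C ∧
      2 * A.card = (pp - 1) * (pm - 1) ∧ B.card = pp * pm ∧ C.card = pp * pm ∧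
      (A ∪ B ∪ C).card = (pp - 1) * (pm - 1) / 2 + 2 * pp * pm := by
  intro A B C
  have hpp₀ : 0 < pp := by lia
  have hpm₀ : 0 < pm := by lia
  have disj_kac : ∀ c : ℤ, 2 ≤ c → Disjoint A
      (((Finset.Icc (1 : ℤ) (pp : ℤ)) ×ˢ (Finset.Icc (1 : ℤ) (pm : ℤ))).image
        (fun x => hRS pp pm (c * (pp : ℤ) - x.1) x.2)) := by
    intro c hc
    simp only [A, Finset.disjoint_left, Finset.mem_image, Finset.mem_product, Finset.mem_Icc]
    rintro _ ⟨⟨r, s⟩, ⟨hr, hs⟩, rfl⟩ ⟨⟨r', s'⟩, ⟨hr', hs'⟩, h⟩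
    exact hRS_ne_hRS_shift_of_mem_kacTable hpp₀ hpm₀ hco hc hr.1 hr.2 hs.1 hs.2
      hr'.1 hr'.2 hs'.2 h.symm
  have hAB : Disjoint A B := disj_kac 2 le_rfl
  have hAC : Disjoint A C := disj_kac 3 (by norm_num)
  have hBC : Disjoint B C := by
    simp only [B, C, Finset.disjoint_left, Finset.mem_image, Finset.mem_product, Finset.mem_Icc]
    rintro _ ⟨⟨r, s⟩, ⟨hr, hs⟩, rfl⟩ ⟨⟨r', s'⟩, ⟨hr', hs'⟩, h⟩
    have := (hRS_shift_inj hpp₀ hpm₀ hco (by norm_num) le_rfl hr'.1 hr'.2 hs'.1 hs'.2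
      hr.1 hr.2 hs.1 hs.2 h).1
    lia
  have hA : 2 * A.card = (pp - 1) * (pm - 1) := two_mul_card_image_hRS_kacTable hpp hpm₀ hco
  have hB : B.card = pp * pm := card_image_hRS_shift hpp₀ hpm₀ hco le_rfl
  have hC : C.card = pp * pm := card_image_hRS_shift hpp₀ hpm₀ hco (by norm_num)
  refine ⟨hAB, hAC, hBC, hA, hB, hC, ?_⟩
  rw [Finset.card_union_of_disjoint (Finset.disjoint_union_left.mpr ⟨hAC, hBC⟩),
    Finset.card_union_of_disjoint hAB, hB, hC, ← hA, mul_assoc]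
  lia
end
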